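/- Assume n < q, and let λ, μ ∈ E satisfy |λ| ≤ |q^{-1}π^{-n-m}|, |μ| ≤ |q^{-1}π^{-n-m}|, and |λμ| = |q^{-1}π^{-n-2m}|. Let k₀ ≤ 0, and for k ≥ k₀ let c′_k, c″_k : W → V_τ be finitely supported (zero for all but finitely many k) with c′_k(β), c″_k(β) ∈ π^{-km}N_k(β) for all k, β. Define C′_l(β) = Σ_{k=k₀}^{l} λ^{l−k} Σ_{π^{l−k}α=β} c′_k(α), C″_l(β) = Σ_{k=k₀}^{l} μ^{l−k} Σ_{π^{l−k}α=β} c″_k(α), and C_l = C′_l + C″_l. Set M_l(β) = q^{-1}π^{-n-lm}N_l(β). If for every l with k₀ ≤ l < 0 one has C_l(β) = C_l(β′) whenever πβ = πβ′, then C_l(β) ∈ M_l(β) for every l with k₀ ≤ l ≤ 0 and every β ∈ W. -/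

import Mathlib

open scoped Classical

noncomputable section

namespace BS

variable (E : Type) [Field E]

/-- The ring of integers of a subfield `F` of `E`, with respect to a nonarchimedean
absolute value on `E`, as an additive subgroup of `F`. -/
def OFadd (abs : AbsoluteValue E ℝ)
    (na : ∀ x y : E, abs (x + y) ≤ max (abs x) (abs y))
    (F : Subfield E) : AddSubgroup F where
  carrier := {x | abs (x : E) ≤ 1}
  zero_mem' := by simp
  add_mem' := by
    intro a b ha hb
    simp only [Set.mem_setOf_eq] at *
    have h : ((a + b : F) : E) = (a : E) + (b : E) := by push_cast; ring
    rw [h]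
    exact le_trans (na _ _) (max_le ha hb)
  neg_mem' := by
    intro a ha
    simp only [Set.mem_setOf_eq] at *
    have h : ((-a : F) : E) = -(a : E) := by push_cast; ring
    rw [h, abs.map_neg]
    exact ha

/-- `W = F/O_F`. -/
abbrev Wq (abs : AbsoluteValue E ℝ)
    (na : ∀ x y : E, abs (x + y) ≤ max (abs x) (abs y))
    (F : Subfield E) : Type := F ⧸ OFadd E abs na F

/-- The canonical projection `F → W = F/O_F`. -/
def mkW (abs : AbsoluteValue E ℝ)
    (na : ∀ x y : E, abs (x + y) ≤ max (abs x) (abs y))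
    (F : Subfield E) : F →+ Wq E abs na F := QuotientAddGroup.mk' _

/-- Multiplication by `π` on `W = F/O_F`. -/
def pmulW (abs : AbsoluteValue E ℝ)
    (na : ∀ x y : E, abs (x + y) ≤ max (abs x) (abs y))
    (F : Subfield E) (π : F) (hπ : abs (π : E) ≤ 1) :
    Wq E abs na F →+ Wq E abs na F :=
  QuotientAddGroup.map _ _ (AddMonoidHom.mulLeft π) (by
    intro x hx
    simp only [AddSubgroup.mem_comap, AddMonoidHom.coe_mulLeft]
    show abs ((π * x : F) : E) ≤ 1
    have h : ((π * x : F) : E) = (π : E) * (x : E) := by push_cast; ring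
    rw [h, abs.map_mul]
    have hx' : abs (x : E) ≤ 1 := hx
    nlinarith [abs.nonneg (x : E), abs.nonneg (π : E)])


/-- The lattice `N_l(β) = {P ∈ E[u]^{≤n} : |P(u)| ≤ |π|^{-nl} for all u ∈ D_l(β)}`, where
`D_l(β) = {u ∈ F : |u − π^{-l}b| ≤ |π^{-l}|}` for any lift `b ∈ F` of `β`. -/
def Nset (abs : AbsoluteValue E ℝ)
    (na : ∀ x y : E, abs (x + y) ≤ max (abs x) (abs y))
    (F : Subfield E) (π : F) (n : ℕ) (l : ℤ) (β : Wq E abs na F) : Set (Polynomial E) :=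
  {P | P.degree ≤ (n : WithBot ℕ) ∧ ∀ b : F, mkW E abs na F b = β → ∀ u : F,
      abs ((u : E) - (π : E) ^ (-l) * (b : E)) ≤ abs ((π : E) ^ (-l)) →
      abs (Polynomial.eval (u : E) P) ≤ abs (π : E) ^ (-((n : ℤ) * l))}

/-- The coefficient `C_l(β) = Σ_{k=k₀}^{l} λ^{l−k} Σ_{α∈W : π^{l−k}α=β} c_k(α)`. -/
def Csum {V : Type} [AddCommGroup V] [Module E V]
    (abs : AbsoluteValue E ℝ)
    (na : ∀ x y : E, abs (x + y) ≤ max (abs x) (abs y))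
    (F : Subfield E) (π : F) (hπ : abs (π : E) ≤ 1)
    (lam : E) (k0 : ℤ) (c : ℤ → Wq E abs na F → V) (l : ℤ) (β : Wq E abs na F) : V :=
  ∑ k ∈ Finset.Icc k0 l, lam ^ (l - k).toNat •
    (∑ᶠ (α : Wq E abs na F) (_ : (⇑(pmulW E abs na F π hπ))^[(l - k).toNat] α = β), c k α)

section Helpers

variable {E}
variable {abs : AbsoluteValue E ℝ} {na : ∀ x y : E, abs (x + y) ≤ max (abs x) (abs y)}
  {F : Subfield E} {π : F}

theorem abs_sum_le_of_forall_le (na : ∀ x y : E, abs (x + y) ≤ max (abs x) (abs y))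
    {ι : Type*} (s : Finset ι) (f : ι → E) {A : ℝ} (hA : 0 ≤ A)
    (h : ∀ i ∈ s, abs (f i) ≤ A) : abs (∑ i ∈ s, f i) ≤ A :=
  Finset.sum_induction f (fun x => abs x ≤ A) (fun _ _ hx hy => (na _ _).trans (max_le hx hy))
    (by simpa using hA) h

theorem abs_natCast_le_one (na : ∀ x y : E, abs (x + y) ≤ max (abs x) (abs y)) (k : ℕ) :
    abs (k : E) ≤ 1 := by
  have := abs_sum_le_of_forall_le na (Finset.range k) (fun _ => (1 : E)) zero_le_one (by simp)
  simpa using this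

theorem mkW_eq_iff {a b : F} :
    mkW E abs na F a = mkW E abs na F b ↔ abs ((a : E) - b) ≤ 1 := by
  rw [mkW, ← sub_eq_zero, ← map_sub, QuotientAddGroup.mk'_apply, QuotientAddGroup.eq_zero_iff]
  show abs ((a - b : F) : E) ≤ 1 ↔ _
  push_cast
  rfl

theorem mkW_surjective : Function.Surjective (mkW E abs na F) :=
  QuotientAddGroup.mk'_surjective _

theorem pmulW_mkW (hπ : abs (π : E) ≤ 1) (a : F) :
    pmulW E abs na F π hπ (mkW E abs na F a) = mkW E abs na F (π * a) := rfl

theorem coe_zpow (x : F) (k : ℤ) : ((x ^ k : F) : E) = (x : E) ^ k :=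
  map_zpow₀ F.subtype x k

theorem abs_coe_pos (abs : AbsoluteValue E ℝ) (hπ0 : π ≠ 0) : 0 < abs (π : E) :=
  abs.pos (by exact_mod_cast hπ0)

/-- The polynomial `Q` has degree at most `n` and is bounded by `A` on the disc `D_l(β)`. -/
def BoundedOnDisc (abs : AbsoluteValue E ℝ)
    (na : ∀ x y : E, abs (x + y) ≤ max (abs x) (abs y))
    (F : Subfield E) (π : F) (n : ℕ) (A : ℝ) (l : ℤ) (β : Wq E abs na F)
    (Q : Polynomial E) : Prop :=
  Q.degree ≤ (n : WithBot ℕ) ∧ ∀ b : F, mkW E abs na F b = β → ∀ u : F,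
    abs ((u : E) - (π : E) ^ (-l) * (b : E)) ≤ abs ((π : E) ^ (-l)) →
    abs (Polynomial.eval (u : E) Q) ≤ A

namespace BoundedOnDisc

variable {n : ℕ} {A B : ℝ} {l : ℤ} {β : Wq E abs na F} {P Q : Polynomial E}

theorem mono (h : BoundedOnDisc abs na F π n A l β Q) (hAB : A ≤ B) :
    BoundedOnDisc abs na F π n B l β Q :=
  ⟨h.1, fun b hb u hu => (h.2 b hb u hu).trans hAB⟩

theorem zero (hA : 0 ≤ A) : BoundedOnDisc abs na F π n A l β 0 :=
  ⟨by simp, fun _ _ _ _ => by simpa using hA⟩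

theorem add (hP : BoundedOnDisc abs na F π n A l β P) (hQ : BoundedOnDisc abs na F π n A l β Q) :
    BoundedOnDisc abs na F π n A l β (P + Q) :=
  ⟨(Polynomial.degree_add_le _ _).trans (max_le hP.1 hQ.1), fun b hb u hu => by
    rw [Polynomial.eval_add]
    exact (na _ _).trans (max_le (hP.2 b hb u hu) (hQ.2 b hb u hu))⟩

theorem smul (hQ : BoundedOnDisc abs na F π n A l β Q) (x : E) :
    BoundedOnDisc abs na F π n (abs x * A) l β (x • Q) :=
  ⟨(Polynomial.degree_smul_le _ _).trans hQ.1, fun b hb u hu => by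
    rw [Polynomial.eval_smul, smul_eq_mul, abs.map_mul]
    exact mul_le_mul_of_nonneg_left (hQ.2 b hb u hu) (abs.nonneg _)⟩

theorem neg (hQ : BoundedOnDisc abs na F π n A l β Q) :
    BoundedOnDisc abs na F π n A l β (-Q) := by
  simpa using hQ.smul (-1)

theorem sub (hP : BoundedOnDisc abs na F π n A l β P) (hQ : BoundedOnDisc abs na F π n A l β Q) :
    BoundedOnDisc abs na F π n A l β (P - Q) := by
  rw [sub_eq_add_neg]
  exact hP.add hQ.neg

theorem sum {ι : Type*} (s : Finset ι) (f : ι → Polynomial E) (hA : 0 ≤ A)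
    (h : ∀ i ∈ s, BoundedOnDisc abs na F π n A l β (f i)) :
    BoundedOnDisc abs na F π n A l β (∑ i ∈ s, f i) :=
  Finset.sum_induction f (BoundedOnDisc abs na F π n A l β) (fun _ _ => add) (zero hA) h

/-- A polynomial bounded by `A` on every disc `D_{l-1}(α)` with `πα = β` is bounded by `A` on
`D_l(β)`, which is the union of these discs. -/
theorem of_fibre (hπ0 : π ≠ 0) (hπ : abs (π : E) ≤ 1)
    (h : ∀ α, pmulW E abs na F π hπ α = β → BoundedOnDisc abs na F π n A (l - 1) α Q) :
    BoundedOnDisc abs na F π n A l β Q := by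
  have hπE : (π : E) ≠ 0 := by exact_mod_cast hπ0
  have key : ∀ b : F, mkW E abs na F b = β → ∀ u : F,
      abs ((u : E) - (π : E) ^ (-l) * (b : E)) ≤ abs ((π : E) ^ (-l)) →
      BoundedOnDisc abs na F π n A (l - 1) (mkW E abs na F (π ^ (l - 1) * u)) Q := by
    intro b hb u hu
    refine h _ ?_
    rw [pmulW_mkW, ← hb, mkW_eq_iff]
    have e : ((π * (π ^ (l - 1) * u) : F) : E) - b
        = (π : E) ^ l * ((u : E) - (π : E) ^ (-l) * (b : E)) := by
      push_cast
      rw [coe_zpow, zpow_sub_one₀ hπE, zpow_neg]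
      field_simp
    rw [e, abs.map_mul]
    calc _ ≤ abs ((π : E) ^ l) * abs ((π : E) ^ (-l)) :=
          mul_le_mul_of_nonneg_left hu (abs.nonneg _)
      _ = 1 := by
          rw [← abs.map_mul, ← zpow_add₀ hπE]
          simp
  refine ⟨?_, fun b hb u hu => ?_⟩
  · obtain ⟨b, hb⟩ := mkW_surjective β
    exact (key b hb (π ^ (-l) * b) (by simp [coe_zpow, zpow_nonneg (abs.nonneg (π : E)) l])).1
  · refine (key b hb u hu).2 _ rfl u ?_
    push_cast
    rw [coe_zpow, ← mul_assoc, ← zpow_add₀ hπE, neg_add_cancel, zpow_zero, one_mul, sub_self,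
      abs.map_zero]
    exact abs.nonneg _

end BoundedOnDisc

/-- In `F` there are `q` points of absolute value at most `1` at pairwise distance at least `1`. -/
theorem exists_nodes (hπ0 : π ≠ 0) (hπ1 : abs (π : E) < 1)
    (hdisc : ∀ x : F, x ≠ 0 → ∃ k : ℤ, abs (x : E) = abs (π : E) ^ k)
    {q n : ℕ} (hn : n < q)
    (hcard : Nat.card {β : Wq E abs na F // pmulW E abs na F π hπ1.le β = 0} = q) :
    ∃ (s : Finset (Wq E abs na F)) (t : Wq E abs na F → F), s.card = n + 1 ∧
      (∀ i ∈ s, abs (t i : E) ≤ 1) ∧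
      ∀ i ∈ s, ∀ j ∈ s, i ≠ j → 1 ≤ abs ((t i : E) - t j) := by
  have hp := abs_coe_pos abs hπ0
  have hfin : {β : Wq E abs na F | pmulW E abs na F π hπ1.le β = 0}.Finite :=
    Nat.finite_of_card_ne_zero (by rw [Set.coe_ofPred, hcard]; omega)
  have hc : hfin.toFinset.card = q := by
    rw [← hcard, ← Set.ncard_eq_toFinset_card _ hfin]
    rfl
  obtain ⟨s, hs, hsc⟩ := Finset.exists_subset_card_eq (s := hfin.toFinset) (n := n + 1)
    (by omega)
  choose g hg using (mkW_surjective : Function.Surjective (mkW E abs na F))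
  refine ⟨s, fun i => π * g i, hsc, fun i hi => ?_, fun i hi j hj hij => ?_⟩
  · have h := hs hi
    rw [Set.Finite.mem_toFinset, Set.mem_ofPred_eq, ← hg i, pmulW_mkW, ← map_zero (mkW E abs na F),
      mkW_eq_iff] at h
    simpa using h
  · have h1 : ¬ abs ((g i : E) - g j) ≤ 1 := by
      rw [← mkW_eq_iff (na := na), hg, hg]
      exact hij
    have hne : g i - g j ≠ 0 := by
      rintro h0
      apply h1
      have : ((g i - g j : F) : E) = 0 := by rw [h0]; rfl
      push_cast at this
      simp [this]
    obtain ⟨k, hk⟩ := hdisc _ hne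
    push_cast at hk
    have hk0 : k ≤ -1 := by
      by_contra! hk'
      apply h1
      rw [hk]
      exact zpow_le_one₀ hp hπ1.le (by omega)
    push_cast
    rw [← mul_sub, abs.map_mul, hk, ← zpow_one_add₀ hp.ne']
    exact one_le_zpow_of_nonpos₀ hp hπ1.le (by omega)

/-- Passing from the disc `D_{l-1}(α)` to the larger disc `D_l(πα)` multiplies the bound of a
polynomial of degree at most `n < q` by at most `|π|^{-n}`. -/
theorem BoundedOnDisc.enlarge (hπ0 : π ≠ 0) (hπ1 : abs (π : E) < 1)
    (hdisc : ∀ x : F, x ≠ 0 → ∃ k : ℤ, abs (x : E) = abs (π : E) ^ k)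
    {q n : ℕ} (hn : n < q)
    (hcard : Nat.card {β : Wq E abs na F // pmulW E abs na F π hπ1.le β = 0} = q)
    {A : ℝ} (hA : 0 ≤ A) {l : ℤ} {α β : Wq E abs na F} {Q : Polynomial E}
    (hαβ : pmulW E abs na F π hπ1.le α = β)
    (h : BoundedOnDisc abs na F π n A (l - 1) α Q) :
    BoundedOnDisc abs na F π n (A * abs (π : E) ^ (-(n : ℤ))) l β Q := by
  have hp := abs_coe_pos abs hπ0
  have hπE : (π : E) ≠ 0 := by exact_mod_cast hπ0
  obtain ⟨s, t, hsc, ht1, ht⟩ := exists_nodes hπ0 hπ1 hdisc hn hcard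
  obtain ⟨a, rfl⟩ := mkW_surjective α
  refine ⟨h.1, fun b hb u hu => ?_⟩
  let v : Wq E abs na F → F := fun i => π ^ (-(l - 1)) * (a + t i)
  have hvsub : ∀ i j, (v i : E) - v j = (π : E) ^ (-(l - 1)) * ((t i : E) - t j) := by
    intro i j
    simp only [v]
    push_cast
    rw [coe_zpow]
    ring
  have hvge : ∀ i ∈ s, ∀ j ∈ s, i ≠ j →
      abs (π : E) ^ (-(l - 1)) ≤ abs ((v i : E) - v j) := by
    intro i hi j hj hij
    rw [hvsub, abs.map_mul, map_zpow₀]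
    exact le_mul_of_one_le_right (zpow_nonneg hp.le _) (ht i hi j hj hij)
  have hvinj : Set.InjOn (fun i => (v i : E)) s := by
    intro i hi j hj hij
    by_contra hne
    have h1 := hvge i hi j hj hne
    rw [show (v i : E) = v j from hij, sub_self, abs.map_zero] at h1
    exact absurd h1 (not_le.2 (zpow_pos hp _))
  have hdeg : Q.degree < (s.card : WithBot ℕ) := by
    rw [hsc]
    exact lt_of_le_of_lt h.1 (by exact_mod_cast Nat.lt_succ_self n)
  have hvbd : ∀ i ∈ s, abs (Polynomial.eval (v i : E) Q) ≤ A := by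
    intro i hi
    refine h.2 a rfl (v i) ?_
    simp only [v]
    push_cast
    rw [coe_zpow, mul_add, add_sub_cancel_left, abs.map_mul]
    exact mul_le_of_le_one_right (abs.nonneg _) (ht1 i hi)
  have huv : ∀ j ∈ s, abs ((u : E) - v j) ≤ abs (π : E) ^ (-l) := by
    intro j hj
    have h1 : abs (((π * a : F) : E) - b) ≤ 1 := by
      rw [← mkW_eq_iff (na := na), hb, ← hαβ, pmulW_mkW]
    have h2 : abs ((b : E) - π * (a + t j)) ≤ 1 := by
      have e : (b : E) - π * (a + t j) = -(((π * a : F) : E) - b) + -(π * t j) := by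
        push_cast
        ring
      rw [e]
      refine (na _ _).trans (max_le ?_ ?_)
      · rwa [abs.map_neg]
      · rw [abs.map_neg, abs.map_mul]
        exact mul_le_one₀ hπ1.le (abs.nonneg _) (ht1 j hj)
    have e : (u : E) - v j = ((u : E) - (π : E) ^ (-l) * b)
        + (π : E) ^ (-l) * ((b : E) - π * (a + t j)) := by
      simp only [v]
      push_cast
      rw [coe_zpow, show -(l - 1) = -l + 1 by ring, zpow_add_one₀ hπE]
      ring
    rw [e, ← map_zpow₀]
    refine (na _ _).trans (max_le hu ?_)
    rw [abs.map_mul]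
    exact mul_le_of_le_one_right (abs.nonneg _) h2
  rw [Lagrange.eq_interpolate hvinj hdeg, Lagrange.interpolate_apply, Polynomial.eval_finsetSum]
  refine abs_sum_le_of_forall_le na s _ (mul_nonneg hA (zpow_nonneg hp.le _)) fun i hi => ?_
  rw [Polynomial.eval_mul, Polynomial.eval_C, abs.map_mul]
  refine mul_le_mul (hvbd i hi) ?_ (abs.nonneg _) hA
  rw [Lagrange.basis, Polynomial.eval_prod, map_prod]
  calc _ ≤ ∏ _j ∈ s.erase i, abs (π : E) ^ (-1 : ℤ) := by
        refine Finset.prod_le_prod (fun _ _ => abs.nonneg _) fun j hj => ?_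
        obtain ⟨hji, hj⟩ := Finset.mem_erase.1 hj
        rw [Lagrange.basisDivisor]
        simp only [Polynomial.eval_mul, Polynomial.eval_C, Polynomial.eval_sub, Polynomial.eval_X]
        rw [abs.map_mul, map_inv₀, inv_mul_le_iff₀ ((zpow_pos hp _).trans_le
          (hvge i hi j hj hji.symm))]
        calc _ ≤ abs (π : E) ^ (-l) := huv j hj
          _ = abs (π : E) ^ (-(l - 1)) * abs (π : E) ^ (-1 : ℤ) := by
              rw [← zpow_add₀ hp.ne']
              congr 1
              ring
          _ ≤ _ := mul_le_mul_of_nonneg_right (hvge i hi j hj hji.symm) (zpow_nonneg hp.le _)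
    _ = abs (π : E) ^ (-(n : ℤ)) := by
        rw [Finset.prod_const, Finset.card_erase_of_mem hi, hsc, Nat.add_sub_cancel,
          ← zpow_natCast, ← zpow_mul]
        congr 1
        ring

theorem exists_mem_Nset_iff {n : ℕ} {l : ℤ} {β : Wq E abs na F}
    {Q : Polynomial E} {x : E} (hx : x ≠ 0) :
    (∃ P ∈ Nset E abs na F π n l β, Q = x • P) ↔
      BoundedOnDisc abs na F π n (abs x * abs (π : E) ^ (-((n : ℤ) * l))) l β Q := by
  constructor
  · rintro ⟨P, hP, rfl⟩
    exact BoundedOnDisc.smul hP x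
  · intro h
    refine ⟨x⁻¹ • Q, ?_, by rw [smul_inv_smul₀ hx]⟩
    have := h.smul x⁻¹
    rwa [map_inv₀, inv_mul_cancel_left₀ (abs.pos hx).ne'] at this

variable {V : Type} [AddCommGroup V] [Module E V]

theorem finite_iterate_fibre {X : Type*} {f : X → X} (hf : ∀ y, {x | f x = y}.Finite) (j : ℕ)
    (y : X) : {x | f^[j] x = y}.Finite := by
  induction j generalizing y with
  | zero => simp
  | succ j ih =>
    refine ((hf y).biUnion fun z _ => ih z).subset fun x hx => ?_
    rw [Set.mem_ofPred_eq, Function.iterate_succ_apply'] at hx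
    exact Set.mem_biUnion (x := f^[j] x) hx rfl

theorem finsum_iterate_succ_fibre {X : Type*} {f : X → X} (hf : ∀ y, {x | f x = y}.Finite)
    (j : ℕ) (y : X) (c : X → V) :
    ∑ᶠ (x : X) (_ : f^[j + 1] x = y), c x =
      ∑ z ∈ (hf y).toFinset, ∑ᶠ (x : X) (_ : f^[j] x = z), c x := by
  have e : {x | f^[j + 1] x = y} = ⋃ z ∈ {z | f z = y}, {x | f^[j] x = z} := by
    ext x
    simp [Function.iterate_succ_apply']
  have h := finsum_mem_biUnion (f := c) (I := {z | f z = y}) (t := fun z => {x | f^[j] x = z})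
    (fun z _ w _ hzw => Set.disjoint_left.2 fun x hx hx' => hzw (hx.symm.trans hx'))
    (hf y) (fun z _ => finite_iterate_fibre hf j z)
  rw [← e, finsum_mem_eq_finite_toFinset_sum _ (hf y)] at h
  exact h

theorem Csum_of_lt (hπ : abs (π : E) ≤ 1) (lam : E) {k0 l : ℤ} (c : ℤ → Wq E abs na F → V)
    (h : l < k0) (β : Wq E abs na F) : Csum E abs na F π hπ lam k0 c l β = 0 := by
  rw [Csum, Finset.Icc_eq_empty (by omega), Finset.sum_empty]

theorem Csum_eq_add (hπ : abs (π : E) ≤ 1)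
    (hf : ∀ β, {α | pmulW E abs na F π hπ α = β}.Finite) (lam : E) {k0 l : ℤ}
    (c : ℤ → Wq E abs na F → V) (β : Wq E abs na F) :
    Csum E abs na F π hπ lam k0 c l β =
      lam • ∑ α ∈ (hf β).toFinset, Csum E abs na F π hπ lam k0 c (l - 1) α +
        if k0 ≤ l then c l β else 0 := by
  split_ifs with h
  · have e : Finset.Icc k0 l = insert l (Finset.Icc k0 (l - 1)) := by
      ext k
      simp only [Finset.mem_Icc, Finset.mem_insert]
      omega
    simp only [Csum]
    rw [e, Finset.sum_insert (by simp), add_comm, Finset.sum_comm, Finset.smul_sum]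
    congr 1
    · refine Finset.sum_congr rfl fun k hk => ?_
      have hk := (Finset.mem_Icc.1 hk).2
      have ej : (l - k).toNat = (l - 1 - k).toNat + 1 := by omega
      rw [ej, finsum_iterate_succ_fibre hf, ← Finset.smul_sum, smul_smul, pow_succ']
    · simp
  · rw [Csum_of_lt _ _ _ (by omega), add_zero, Finset.sum_eq_zero, smul_zero]
    intro α _
    exact Csum_of_lt _ _ _ (by omega) α

theorem Csum_add_Csum_eq (hπ : abs (π : E) ≤ 1)
    (hf : ∀ β, {α | pmulW E abs na F π hπ α = β}.Finite) (lam mu : E) {k0 l : ℤ}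
    (c' c'' : ℤ → Wq E abs na F → V) (β : Wq E abs na F) :
    Csum E abs na F π hπ lam k0 c' l β + Csum E abs na F π hπ mu k0 c'' l β =
      (lam + mu) • ∑ α ∈ (hf β).toFinset,
          (Csum E abs na F π hπ lam k0 c' (l - 1) α + Csum E abs na F π hπ mu k0 c'' (l - 1) α) -
        (lam * mu) • ∑ α ∈ (hf β).toFinset, ∑ γ ∈ (hf α).toFinset,
          (Csum E abs na F π hπ lam k0 c' (l - 1 - 1) γ +
            Csum E abs na F π hπ mu k0 c'' (l - 1 - 1) γ) -
        ∑ α ∈ (hf β).toFinset, mu • (if k0 ≤ l - 1 then c' (l - 1) α else 0) -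
        ∑ α ∈ (hf β).toFinset, lam • (if k0 ≤ l - 1 then c'' (l - 1) α else 0) +
        ((if k0 ≤ l then c' l β else 0) + if k0 ≤ l then c'' l β else 0) := by
  rw [Csum_eq_add hπ hf lam c', Csum_eq_add hπ hf mu c'', add_add_add_comm]
  congr 1
  simp only [Finset.smul_sum (s := (hf β).toFinset)]
  rw [← Finset.sum_add_distrib, ← Finset.sum_sub_distrib, ← Finset.sum_sub_distrib,
    ← Finset.sum_sub_distrib]
  refine Finset.sum_congr rfl fun α _ => ?_
  rw [Csum_eq_add hπ hf lam c' α, Csum_eq_add hπ hf mu c'' α, Finset.sum_add_distrib]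
  module

end Helpers

/-- the inductive bound in the unramified case (Lemma 3.2 of the paper):
under the Breuil–Schneider estimates on `λ, μ` and `n < q`, if the coefficients
`c′_k(β), c″_k(β)` lie in `π^{-km}N_k(β)` and `C_l(β)` depends only on `πβ` for
`k₀ ≤ l < 0`, then `C_l(β) ∈ M_l(β) = q^{-1}π^{-n-lm}N_l(β)` for all `k₀ ≤ l ≤ 0`. -/
theorem stmt14 [CharZero E]
    (abs : AbsoluteValue E ℝ)
    (na : ∀ x y : E, abs (x + y) ≤ max (abs x) (abs y))
    (F : Subfield E) (π : F)
    (hπ0 : π ≠ 0) (hπ1 : abs (π : E) < 1)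
    (hdisc : ∀ x : F, x ≠ 0 → ∃ k : ℤ, abs (x : E) = abs (π : E) ^ k)
    -- the residue field has `q` elements
    (q : ℕ) (hq : 0 < q)
    (hcard : ∀ γ : Wq E abs na F,
      Nat.card {β : Wq E abs na F // pmulW E abs na F π hπ1.le β = γ} = q)
    (m : ℤ) (n : ℕ) (hn : n < q)
    -- the Breuil–Schneider estimates on `λ` and `μ`:
    (lam mu : E)
    (hlam : abs lam ≤ abs ((q : E)⁻¹ * (π : E) ^ (-((n : ℤ) + m))))
    (hmu : abs mu ≤ abs ((q : E)⁻¹ * (π : E) ^ (-((n : ℤ) + m))))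
    (hlammu : abs (lam * mu) = abs ((q : E)⁻¹ * (π : E) ^ (-((n : ℤ) + 2 * m))))
    (k0 : ℤ) (hk0 : k0 ≤ 0)
    (c' c'' : ℤ → Wq E abs na F → Polynomial E)
    (hfin : ∀ k : ℤ, {β | c' k β ≠ 0}.Finite ∧ {β | c'' k β ≠ 0}.Finite)
    (hfink : {k : ℤ | c' k ≠ 0 ∨ c'' k ≠ 0}.Finite)
    -- `c′_k(β), c″_k(β) ∈ π^{-km}N_k(β)`:
    (hc' : ∀ (k : ℤ) (β : Wq E abs na F), ∃ P ∈ Nset E abs na F π n k β,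
      c' k β = ((π : E) ^ (-(k * m))) • P)
    (hc'' : ∀ (k : ℤ) (β : Wq E abs na F), ∃ P ∈ Nset E abs na F π n k β,
      c'' k β = ((π : E) ^ (-(k * m))) • P)
    -- for `k₀ ≤ l < 0`, `C_l(β)` depends only on `πβ`:
    (hdep : ∀ l : ℤ, k0 ≤ l → l < 0 → ∀ β β' : Wq E abs na F,
      pmulW E abs na F π hπ1.le β = pmulW E abs na F π hπ1.le β' →
      Csum E abs na F π hπ1.le lam k0 c' l β + Csum E abs na F π hπ1.le mu k0 c'' l β =
        Csum E abs na F π hπ1.le lam k0 c' l β' + Csum E abs na F π hπ1.le mu k0 c'' l β') :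
    -- conclusion: `C_l(β) ∈ M_l(β) = q^{-1}π^{-n-lm}N_l(β)` for `k₀ ≤ l ≤ 0`:
    ∀ l : ℤ, k0 ≤ l → l ≤ 0 → ∀ β : Wq E abs na F,
      ∃ P ∈ Nset E abs na F π n l β,
        Csum E abs na F π hπ1.le lam k0 c' l β + Csum E abs na F π hπ1.le mu k0 c'' l β =
          ((q : E)⁻¹ * (π : E) ^ (-((n : ℤ) + l * m))) • P := by
  have hp := abs_coe_pos abs hπ0
  have hπE : (π : E) ≠ 0 := by exact_mod_cast hπ0
  have hqE : (q : E) ≠ 0 := by exact_mod_cast hq.ne'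
  have hf : ∀ β, {α | pmulW E abs na F π hπ1.le α = β}.Finite := fun β =>
    Nat.finite_of_card_ne_zero (by rw [Set.coe_ofPred, hcard]; omega)
  have hfc : ∀ β, (hf β).toFinset.card = q := fun β => by
    rw [← hcard β, ← Set.ncard_eq_toFinset_card _ (hf β)]
    rfl
  have habsq : 0 < abs (q : E) := abs.pos hqE
  have hq1 : 1 ≤ (abs (q : E))⁻¹ := (one_le_inv₀ habsq).2 (abs_natCast_le_one na q)
  simp only [abs.map_mul, map_inv₀, map_zpow₀] at hlam hmu hlammu
  set C : ℤ → Wq E abs na F → Polynomial E := fun l β =>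
    Csum E abs na F π hπ1.le lam k0 c' l β + Csum E abs na F π hπ1.le mu k0 c'' l β with hC
  let R : ℤ → ℝ := fun l =>
    (abs (q : E))⁻¹ * abs (π : E) ^ (-((n : ℤ) + l * m)) * abs (π : E) ^ (-((n : ℤ) * l))
  have hR0 : ∀ l, 0 ≤ R l := fun l => by positivity
  have hClt : ∀ l, l < k0 → ∀ β, C l β = 0 := fun l hl β => by
    simp only [hC, Csum_of_lt _ _ _ hl, add_zero]
  have hCdep : ∀ l, l < 0 → ∀ β β' : Wq E abs na F,
      pmulW E abs na F π hπ1.le β = pmulW E abs na F π hπ1.le β' → C l β = C l β' := by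
    intro l hl β β' h
    rcases lt_or_ge l k0 with hk | hk
    · rw [hClt l hk, hClt l hk]
    · exact hdep l hk hl β β' h
  have hsumC : ∀ l, l < 0 → (∀ α, BoundedOnDisc abs na F π n (R l) l α (C l α)) → ∀ β,
      BoundedOnDisc abs na F π n (abs (q : E) * R l) (l + 1) β
        (∑ α ∈ (hf β).toFinset, C l α) := by
    intro l hl h β
    obtain ⟨α₀, hα₀⟩ : (hf β).toFinset.Nonempty := by
      rw [← Finset.card_pos, hfc]
      exact hq
    have hα₀' : pmulW E abs na F π hπ1.le α₀ = β := by simpa using hα₀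
    have hconst : ∀ α, pmulW E abs na F π hπ1.le α = β → C l α = C l α₀ := fun α hα =>
      hCdep l hl α α₀ (hα.trans hα₀'.symm)
    rw [Finset.sum_congr rfl fun α hα => hconst α (by simpa using hα), Finset.sum_const, hfc,
      ← Nat.cast_smul_eq_nsmul E]
    refine BoundedOnDisc.smul (BoundedOnDisc.of_fibre hπ0 hπ1.le fun α hα => ?_) _
    rw [add_sub_cancel_right, ← hconst α hα]
    exact h α
  have hcb : ∀ c : ℤ → Wq E abs na F → Polynomial E,
      (∀ (k : ℤ) (β : Wq E abs na F), ∃ P ∈ Nset E abs na F π n k β,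
        c k β = ((π : E) ^ (-(k * m))) • P) → ∀ l β,
      BoundedOnDisc abs na F π n
        (abs (π : E) ^ (-(l * m)) * abs (π : E) ^ (-((n : ℤ) * l))) l β
        (if k0 ≤ l then c l β else 0) := by
    intro c hc l β
    split_ifs
    · have h := (exists_mem_Nset_iff (zpow_ne_zero _ hπE)).1 (hc l β)
      rwa [map_zpow₀] at h
    · exact BoundedOnDisc.zero (by positivity)
  have hcR : ∀ l : ℤ, abs (π : E) ^ (-(l * m)) * abs (π : E) ^ (-((n : ℤ) * l)) ≤ R l := by
    intro l
    refine mul_le_mul_of_nonneg_right ?_ (by positivity)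
    rw [neg_add, zpow_add₀ hp.ne', ← mul_assoc]
    refine le_mul_of_one_le_left (by positivity) (one_le_mul_of_one_le_of_one_le hq1 ?_)
    exact one_le_zpow_of_nonpos₀ hp hπ1.le (by omega)
  have hUc : ∀ (x : E), abs x ≤ (abs (q : E))⁻¹ * abs (π : E) ^ (-((n : ℤ) + m)) →
      ∀ c : ℤ → Wq E abs na F → Polynomial E,
      (∀ (k : ℤ) (β : Wq E abs na F), ∃ P ∈ Nset E abs na F π n k β,
        c k β = ((π : E) ^ (-(k * m))) • P) → ∀ l β,
      BoundedOnDisc abs na F π n (R l) l β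
        (∑ α ∈ (hf β).toFinset, x • (if k0 ≤ l - 1 then c (l - 1) α else 0)) := by
    intro x hx c hc l β
    refine BoundedOnDisc.sum _ _ (hR0 l) fun α hα => ?_
    have hα : pmulW E abs na F π hπ1.le α = β := by simpa using hα
    refine (((hcb c hc (l - 1) α).enlarge hπ0 hπ1 hdisc hn (hcard 0) (by positivity) hα).smul
      x).mono ?_
    refine (mul_le_mul_of_nonneg_right hx (by positivity)).trans_eq ?_
    simp only [R, mul_assoc, ← zpow_add₀ hp.ne']
    ring_nf
  have step : ∀ l : ℤ, l ≤ 0 →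
      (∀ β, BoundedOnDisc abs na F π n (R (l - 1)) (l - 1) β (C (l - 1) β)) →
      (∀ β, BoundedOnDisc abs na F π n (R (l - 1 - 1)) (l - 1 - 1) β (C (l - 1 - 1) β)) →
      ∀ β, BoundedOnDisc abs na F π n (R l) l β (C l β) := by
    intro l hl h1 h2 β
    have hrec : C l β = _ := Csum_add_Csum_eq hπ1.le hf lam mu c' c'' β
    rw [hrec]
    refine (((BoundedOnDisc.sub ?_ ?_).sub (hUc mu hmu c' hc' l β)).sub
      (hUc lam hlam c'' hc'' l β)).add
      (((hcb c' hc' l β).mono (hcR l)).add ((hcb c'' hc'' l β).mono (hcR l)))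
    · have h := (hsumC (l - 1) (by omega) h1 β).smul (lam + mu)
      rw [sub_add_cancel] at h
      refine h.mono ((mul_le_mul_of_nonneg_right ((na _ _).trans (max_le hlam hmu))
        (mul_nonneg habsq.le (hR0 _))).trans_eq ?_)
      simp only [R]
      have e (a b c : ℝ) : (abs (q : E))⁻¹ * a * (abs (q : E) * ((abs (q : E))⁻¹ * b * c))
          = (abs (q : E))⁻¹ * (a * (b * c)) := by
        field_simp
      rw [e]
      simp only [mul_assoc, ← zpow_add₀ hp.ne']
      ring_nf
    · rw [Finset.smul_sum]
      refine BoundedOnDisc.sum _ _ (hR0 l) fun α hα => ?_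
      have hα : pmulW E abs na F π hπ1.le α = β := by simpa using hα
      have h := hsumC (l - 1 - 1) (by omega) h2 α
      rw [sub_add_cancel] at h
      refine ((h.enlarge hπ0 hπ1 hdisc hn (hcard 0) (mul_nonneg habsq.le (hR0 _)) hα).smul
        (lam * mu)).mono (le_of_eq ?_)
      rw [abs.map_mul, hlammu]
      simp only [R]
      have e (a b c d : ℝ) :
          (abs (q : E))⁻¹ * a * (abs (q : E) * ((abs (q : E))⁻¹ * b * c) * d)
            = (abs (q : E))⁻¹ * (a * (b * (c * d))) := by
        field_simp
      rw [e]
      simp only [mul_assoc, ← zpow_add₀ hp.ne']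
      ring_nf
  have main : ∀ l, k0 - 1 ≤ l →
      (l ≤ 0 → ∀ β, BoundedOnDisc abs na F π n (R l) l β (C l β)) ∧
      (l ≤ 0 → ∀ β, BoundedOnDisc abs na F π n (R (l - 1)) (l - 1) β (C (l - 1) β)) := by
    intro l hl
    induction l, hl using Int.leInduction with
    | base =>
      refine ⟨fun _ β => ?_, fun _ β => ?_⟩ <;> rw [hClt _ (by omega)] <;>
        exact BoundedOnDisc.zero (hR0 _)
    | succ l hl ih =>
      rw [add_sub_cancel_right]
      refine ⟨fun h => step (l + 1) h ?_ ?_, fun h => ih.1 (by omega)⟩ <;>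
        rw [add_sub_cancel_right]
      · exact ih.1 (by omega)
      · exact ih.2 (by omega)
  intro l hl hl0 β
  refine (exists_mem_Nset_iff (mul_ne_zero (inv_ne_zero hqE) (zpow_ne_zero _ hπE))).2 ?_
  rw [abs.map_mul, map_inv₀, map_zpow₀]
  exact (main l (by omega)).1 hl0 β

end BS
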